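/- arXiv:2410.23536 — 5 statements merged into one kernel-verified Lean document; each statement's English description precedes it below -/
import Mathlib

section
/- Let 𝔛 ⊂ ℝ^m be a nonempty compact set equipped with a norm ‖·‖ on ℝ^m, let x̂_1, …, x̂_N ∈ 𝔛, let ε > 0, and let f : ℝ^m → ℝ be continuous on 𝔛. Then strong duality holds: inf { (1/N) Σ_{j=1}^N ∫ f dF_j : F_1, …, F_N Borel probability measures supported on 𝔛 with (1/N) Σ_{j=1}^N ∫ ‖x − x̂_j‖ dF_j(x) ≤ ε } = sup_{λ ≥ 0} [ −λε + (1/N) Σ_{j=1}^N inf_{x ∈ 𝔛} ( f(x) + λ‖x − x̂_j‖ ) ]. -/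
open MeasureTheory

/-- A Lagrange multiplier for a convex set of (constraint, objective) pairs under Slater's
condition. -/
lemma exists_lagrange_multiplier_of_convex {K : Set (ℝ × ℝ)} (hK : Convex ℝ K) {P ε : ℝ}
    (hP : ∀ p ∈ K, p.1 ≤ ε → P ≤ p.2) {q : ℝ × ℝ} (hq : q ∈ K) (hqε : q.1 < ε) :
    ∃ l : ℝ, 0 ≤ l ∧ ∀ p ∈ K, P ≤ p.2 + l * (p.1 - ε) := by
  have cross : ∀ p ∈ K, ε < p.1 → ∀ r ∈ K, r.1 < ε →
      (P - p.2) / (p.1 - ε) ≤ (r.2 - P) / (ε - r.1) := by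
    intro p hp hpε r hr hrε
    have hd : 0 < p.1 - r.1 := by linarith
    have h1 : 0 < p.1 - ε := by linarith
    have h2 : 0 < ε - r.1 := by linarith
    have hmem := hK hp hr (a := (ε - r.1) / (p.1 - r.1)) (b := (p.1 - ε) / (p.1 - r.1))
      (by positivity) (by positivity) (by field_simp; ring)
    have hle := hP _ hmem (by
      apply le_of_eq
      simp only [Prod.fst_add, Prod.smul_fst, smul_eq_mul]
      field_simp
      ring)
    simp only [Prod.snd_add, Prod.smul_snd, smul_eq_mul] at hle
    have heq : (ε - r.1) / (p.1 - r.1) * p.2 + (p.1 - ε) / (p.1 - r.1) * r.2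
        = ((ε - r.1) * p.2 + (p.1 - ε) * r.2) / (p.1 - r.1) := by ring
    rw [heq, le_div_iff₀ hd] at hle
    rw [div_le_div_iff₀ h1 h2]
    linarith
  set S : Set ℝ := insert 0 {s | ∃ p ∈ K, ε < p.1 ∧ s = (P - p.2) / (p.1 - ε)} with hS
  have hub : ∀ r ∈ K, r.1 < ε → (r.2 - P) / (ε - r.1) ∈ upperBounds S := by
    rintro r hr hrε s (rfl | ⟨p, hp, hpε, rfl⟩)
    · exact div_nonneg (sub_nonneg.2 (hP r hr hrε.le)) (by linarith)
    · exact cross p hp hpε r hr hrε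
  have hbdd : BddAbove S := ⟨_, hub q hq hqε⟩
  refine ⟨sSup S, le_csSup hbdd (Set.mem_insert _ _), fun p hp => ?_⟩
  rcases lt_trichotomy p.1 ε with h | h | h
  · have h2 : 0 < ε - p.1 := by linarith
    have := csSup_le ⟨0, Set.mem_insert _ _⟩ (hub p hp h)
    rw [le_div_iff₀ h2] at this
    linarith
  · have := hP p hp h.le
    rw [h]
    linarith
  · have h2 : 0 < p.1 - ε := by linarith
    have := le_csSup hbdd (Set.mem_insert_of_mem 0 ⟨p, hp, h, rfl⟩)
    rw [div_le_iff₀ h2] at this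
    linarith

/-- A function satisfying the seminorm laws on a finite-dimensional coordinate space is
continuous. -/
lemma continuous_of_smul_of_add_le {m : ℕ} {nrm : (Fin m → ℝ) → ℝ}
    (hsmul : ∀ (a : ℝ) (x : Fin m → ℝ), nrm (a • x) = |a| * nrm x)
    (htri : ∀ x y, nrm (x + y) ≤ nrm x + nrm y) : Continuous nrm := by
  have h : ConvexOn ℝ Set.univ nrm :=
    (Seminorm.of (𝕜 := ℝ) nrm htri hsmul).convexOn
  exact continuousOn_univ.1 (h.continuousOn isOpen_univ)

/-- A function continuous on a compact set is integrable against finite measures carried by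
that set. -/
lemma ContinuousOn.integrable_of_measure_eq_one {E : Type*} [TopologicalSpace E] [T2Space E]
    [MeasurableSpace E] [BorelSpace E] {X : Set E}
    (hX : IsCompact X) {μ : Measure E} [IsProbabilityMeasure μ] (hμ : μ X = 1) {g : E → ℝ}
    (hg : ContinuousOn g X) : Integrable g μ := by
  have hae : ∀ᵐ x ∂μ, x ∈ X := (mem_ae_iff_prob_eq_one hX.measurableSet).2 hμ
  rw [← Measure.restrict_eq_self_of_ae_mem hae]
  exact hg.integrableOn_compact hX

/-- The infimum of a continuous function on a compact set bounds its mean from below, for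
probability measures carried by that set. -/
lemma ContinuousOn.sInf_image_le_integral {E : Type*} [TopologicalSpace E] [T2Space E]
    [MeasurableSpace E] [BorelSpace E] {X : Set E}
    (hX : IsCompact X) {μ : Measure E} [IsProbabilityMeasure μ] (hμ : μ X = 1) {g : E → ℝ}
    (hg : ContinuousOn g X) : sInf (g '' X) ≤ ∫ x, g x ∂μ := by
  have hae : ∀ᵐ x ∂μ, x ∈ X := (mem_ae_iff_prob_eq_one hX.measurableSet).2 hμ
  have h : ∫ _, sInf (g '' X) ∂μ ≤ ∫ x, g x ∂μ := by
    refine integral_mono_ae (integrable_const _) (hg.integrable_of_measure_eq_one hX hμ) ?_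
    filter_upwards [hae] with x hx
    exact csInf_le (hX.image_of_continuousOn hg).bddBelow (Set.mem_image_of_mem g hx)
  simpa using h

/-- The (cost, objective) pairs attained by families of probability measures carried by `X`. -/
def momentPairs {ι E : Type*} [Fintype ι] [MeasurableSpace E] (X : Set E)
    (c : ι → E → ℝ) (f : E → ℝ) (w : ℝ) : Set (ℝ × ℝ) :=
  {p | ∃ F : ι → Measure E, (∀ j, IsProbabilityMeasure (F j)) ∧ (∀ j, F j X = 1) ∧
    p = (w * ∑ j, ∫ x, c j x ∂(F j), w * ∑ j, ∫ x, f x ∂(F j))}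

lemma convex_momentPairs {ι E : Type*} [Fintype ι] [TopologicalSpace E] [T2Space E]
    [MeasurableSpace E] [BorelSpace E] {X : Set E} (hX : IsCompact X)
    {c : ι → E → ℝ} (hc : ∀ j, ContinuousOn (c j) X) {f : E → ℝ} (hf : ContinuousOn f X)
    (w : ℝ) : Convex ℝ (momentPairs X c f w) := by
  rintro _ ⟨F, hF, hFX, rfl⟩ _ ⟨G, hG, hGX, rfl⟩ a b ha hb hab
  have hmix : ∀ (j : ι) (g : E → ℝ), ContinuousOn g X →
      ∫ x, g x ∂(ENNReal.ofReal a • F j + ENNReal.ofReal b • G j)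
        = a * ∫ x, g x ∂(F j) + b * ∫ x, g x ∂(G j) := by
    intro j g hg
    have := hF j
    have := hG j
    rw [integral_add_measure
      ((hg.integrable_of_measure_eq_one hX (hFX j)).smul_measure ENNReal.ofReal_ne_top)
      ((hg.integrable_of_measure_eq_one hX (hGX j)).smul_measure ENNReal.ofReal_ne_top),
      integral_smul_measure, integral_smul_measure, ENNReal.toReal_ofReal ha,
      ENNReal.toReal_ofReal hb, smul_eq_mul, smul_eq_mul]
  have hone : ENNReal.ofReal a + ENNReal.ofReal b = 1 := by
    rw [← ENNReal.ofReal_add ha hb, hab, ENNReal.ofReal_one]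
  refine ⟨fun j => ENNReal.ofReal a • F j + ENNReal.ofReal b • G j, fun j => ⟨?_⟩,
    fun j => ?_, ?_⟩
  · have := hF j
    have := hG j
    simpa using hone
  · simpa [hFX j, hGX j] using hone
  · simp only [hmix _ _ (hc _), hmix _ _ hf, Finset.sum_add_distrib, ← Finset.mul_sum]
    ext <;> simp <;> ring

lemma dirac_mem_momentPairs {ι E : Type*} [Fintype ι] [MeasurableSpace E]
    [MeasurableSingletonClass E] {X : Set E} {y : ι → E} (hy : ∀ j, y j ∈ X)
    (c : ι → E → ℝ) (f : E → ℝ) (w : ℝ) :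
    (w * ∑ j, c j (y j), w * ∑ j, f (y j)) ∈ momentPairs X c f w :=
  ⟨fun j => Measure.dirac (y j), fun _ => inferInstance,
    fun j => Measure.dirac_apply_of_mem (hy j), by simp⟩

/-- Weak duality: the dual function bounds the Lagrangian from below. -/
lemma dual_le_of_mem_momentPairs {ι E : Type*} [Fintype ι] [TopologicalSpace E] [T2Space E]
    [MeasurableSpace E] [BorelSpace E] {X : Set E} (hX : IsCompact X)
    {c : ι → E → ℝ} (hc : ∀ j, ContinuousOn (c j) X) {f : E → ℝ} (hf : ContinuousOn f X)
    {w : ℝ} (hw : 0 ≤ w) (l : ℝ) {p : ℝ × ℝ} (hp : p ∈ momentPairs X c f w) :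
    w * ∑ j, sInf ((fun x => f x + l * c j x) '' X) ≤ p.2 + l * p.1 := by
  obtain ⟨F, hF, hFX, rfl⟩ := hp
  have h : ∑ j, sInf ((fun x => f x + l * c j x) '' X)
      ≤ ∑ j, (∫ x, f x ∂(F j) + l * ∫ x, c j x ∂(F j)) := by
    refine Finset.sum_le_sum fun j _ => ?_
    have := hF j
    have hlc : ContinuousOn (fun x => l * c j x) X := continuousOn_const.mul (hc j)
    rw [← integral_const_mul, ← integral_add (hf.integrable_of_measure_eq_one hX (hFX j))
      (hlc.integrable_of_measure_eq_one hX (hFX j))]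
    exact (hf.add hlc).sInf_image_le_integral hX (hFX j)
  refine (mul_le_mul_of_nonneg_left h hw).trans_eq ?_
  rw [Finset.sum_add_distrib, ← Finset.mul_sum]
  ring

/-- Strong duality for the inner minimization (key step of Theorem 3):
for a nonempty compact `𝔛 ⊂ ℝᵐ` equipped with a norm `nrm`, samples `x̂ⱼ ∈ 𝔛`,
radius `ε > 0` and `f` continuous on `𝔛`,
`inf { (1/N) ∑ⱼ ∫ f dFⱼ : Fⱼ prob. measures on 𝔛, (1/N) ∑ⱼ ∫ ‖x − x̂ⱼ‖ dFⱼ ≤ ε }`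
equals `sup_{λ ≥ 0} [ −λε + (1/N) ∑ⱼ inf_{x ∈ 𝔛} ( f(x) + λ‖x − x̂ⱼ‖ ) ]`. -/
theorem strong_duality_inner_minimization
    (m N : ℕ) (hN : 0 < N)
    (nrm : (Fin m → ℝ) → ℝ)
    (hnrm_zero : ∀ x, nrm x = 0 ↔ x = 0)
    (hnrm_smul : ∀ (a : ℝ) (x : Fin m → ℝ), nrm (a • x) = |a| * nrm x)
    (hnrm_tri : ∀ x y, nrm (x + y) ≤ nrm x + nrm y)
    (X : Set (Fin m → ℝ)) (hXne : X.Nonempty) (hXc : IsCompact X)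
    (xs : Fin N → (Fin m → ℝ)) (hxsX : ∀ j, xs j ∈ X)
    (ε : ℝ) (hε : 0 < ε)
    (f : (Fin m → ℝ) → ℝ) (hf : ContinuousOn f X) :
    sInf {r : ℝ | ∃ F : Fin N → Measure (Fin m → ℝ),
        (∀ j, IsProbabilityMeasure (F j)) ∧ (∀ j, F j X = 1) ∧
        (1 / N : ℝ) * ∑ j, ∫ x, nrm (x - xs j) ∂(F j) ≤ ε ∧
        r = (1 / N : ℝ) * ∑ j, ∫ x, f x ∂(F j)}
      = sSup {r : ℝ | ∃ l : ℝ, 0 ≤ l ∧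
          r = -l * ε + (1 / N : ℝ) *
            ∑ j, sInf ((fun x => f x + l * nrm (x - xs j)) '' X)} := by
  have hnc : Continuous nrm := continuous_of_smul_of_add_le hnrm_smul hnrm_tri
  have hc : ∀ j, ContinuousOn (fun x => nrm (x - xs j)) X := fun j =>
    (hnc.comp (continuous_id.sub continuous_const)).continuousOn
  have hw : (0 : ℝ) ≤ 1 / N := by positivity
  set K := momentPairs X (fun j x => nrm (x - xs j)) f (1 / N : ℝ) with hK
  have hprimal : {r : ℝ | ∃ F : Fin N → Measure (Fin m → ℝ),
        (∀ j, IsProbabilityMeasure (F j)) ∧ (∀ j, F j X = 1) ∧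
        (1 / N : ℝ) * ∑ j, ∫ x, nrm (x - xs j) ∂(F j) ≤ ε ∧
        r = (1 / N : ℝ) * ∑ j, ∫ x, f x ∂(F j)} = {r | ∃ p ∈ K, p.1 ≤ ε ∧ r = p.2} := by
    ext r
    constructor
    · rintro ⟨F, hF, hFX, hle, rfl⟩
      exact ⟨_, ⟨F, hF, hFX, rfl⟩, hle, rfl⟩
    · rintro ⟨_, ⟨F, hF, hFX, rfl⟩, hle, rfl⟩
      exact ⟨F, hF, hFX, hle, rfl⟩
  rw [hprimal]
  have hweak : ∀ l : ℝ, 0 ≤ l → ∀ p ∈ K, p.1 ≤ ε → -l * ε + (1 / N : ℝ) *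
      ∑ j, sInf ((fun x => f x + l * nrm (x - xs j)) '' X) ≤ p.2 := by
    intro l hl p hp hpε
    have h1 := dual_le_of_mem_momentPairs hXc hc hf hw l hp
    have h2 := mul_le_mul_of_nonneg_left hpε hl
    linarith
  have hslater : (0, (1 / N : ℝ) * ∑ j, f (xs j)) ∈ K := by
    have h := dirac_mem_momentPairs hxsX (fun j x => nrm (x - xs j)) f (1 / N : ℝ)
    simpa [hK, (hnrm_zero 0).2 rfl] using h
  have hbdd : BddBelow {r | ∃ p ∈ K, p.1 ≤ ε ∧ r = p.2} := by
    refine ⟨-0 * ε + (1 / N : ℝ) *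
      ∑ j, sInf ((fun x => f x + 0 * nrm (x - xs j)) '' X), ?_⟩
    rintro _ ⟨p, hp, hpε, rfl⟩
    exact hweak 0 le_rfl p hp hpε
  have hne : {r | ∃ p ∈ K, p.1 ≤ ε ∧ r = p.2}.Nonempty := ⟨_, _, hslater, hε.le, rfl⟩
  have hdual : ∀ r ∈ {r : ℝ | ∃ l : ℝ, 0 ≤ l ∧ r = -l * ε + (1 / N : ℝ) *
      ∑ j, sInf ((fun x => f x + l * nrm (x - xs j)) '' X)},
      r ≤ sInf {r | ∃ p ∈ K, p.1 ≤ ε ∧ r = p.2} := by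
    rintro _ ⟨l, hl, rfl⟩
    refine le_csInf hne ?_
    rintro _ ⟨p, hp, hpε, rfl⟩
    exact hweak l hl p hp hpε
  refine le_antisymm ?_ (csSup_le ⟨_, 0, le_rfl, rfl⟩ hdual)
  obtain ⟨l, hl, hmul⟩ := exists_lagrange_multiplier_of_convex
    (convex_momentPairs hXc hc hf (1 / N : ℝ))
    (fun p hp hpε => csInf_le hbdd ⟨p, hp, hpε, rfl⟩) hslater hε
  refine le_csSup_of_le ⟨_, hdual⟩ ⟨l, hl, rfl⟩ ?_
  have hmin : ∀ j, ∃ y ∈ X, sInf ((fun x => f x + l * nrm (x - xs j)) '' X)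
      = f y + l * nrm (y - xs j) := fun j =>
    hXc.exists_sInf_image_eq hXne (hf.add (continuousOn_const.mul (hc j)))
  choose y hy hyeq using hmin
  have h := hmul _ (dirac_mem_momentPairs hy (fun j x => nrm (x - xs j)) f (1 / N : ℝ))
  refine h.trans_eq ?_
  simp only [hyeq, Finset.sum_add_distrib, ← Finset.mul_sum]
  ring
end

section
/- Let ‖·‖ be a norm on ℝ^m with dual norm ‖·‖_*, let 𝔛 ⊆ ℝ^m be a set, let x̂_1, …, x̂_N ∈ ℝ^m, and let c : ℝ^m → ℝ be a concave function. Then the set of tuples (w, λ, s, z_1, …, z_N) ∈ ℝ^m × ℝ × ℝ^N × (ℝ^m)^N satisfying: (i) w lies in the standard simplex 𝒲; (ii) c(w) + ⟨w, x⟩ > 0 for all x ∈ 𝔛; (iii) λ ≥ 0; (iv) ‖z_j‖_* ≤ λ for all j; and (v) log(c(w) + ⟨w, x⟩) + ⟨z_j, x − x̂_j⟩ ≥ s_j for all x ∈ 𝔛 and all j, is a convex subset of ℝ^m × ℝ × ℝ^N × (ℝ^m)^N. -/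
/-- The dual norm `‖z‖_* = sup{⟨z, x⟩ : ‖x‖ ≤ 1}` associated to a norm `nrm` on `ℝᵐ`. -/
noncomputable def dualNorm (m : ℕ) (nrm : (Fin m → ℝ) → ℝ) (z : Fin m → ℝ) : ℝ :=
  sSup {p : ℝ | ∃ x : Fin m → ℝ, nrm x ≤ 1 ∧ p = ∑ i, z i * x i}

/-- In finite dimension a linear functional is bounded on the unit ball of any norm. -/
theorem exists_forall_le_of_norm_le_one {E : Type*} [AddCommGroup E] [Module ℝ E]
    [FiniteDimensional ℝ E] (nrm : E → ℝ) (hzero : ∀ x, nrm x = 0 ↔ x = 0)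
    (hsmul : ∀ (a : ℝ) (x : E), nrm (a • x) = |a| * nrm x)
    (htri : ∀ x y, nrm (x + y) ≤ nrm x + nrm y) (f : E →ₗ[ℝ] ℝ) :
    ∃ C, ∀ x, nrm x ≤ 1 → f x ≤ C := by
  let N : AddGroupNorm E :=
    { toFun := nrm
      map_zero' := (hzero 0).2 rfl
      add_le' := htri
      neg' := fun x => by simpa using hsmul (-1) x
      eq_zero_of_map_eq_zero' := fun x => (hzero x).1 }
  let _ : NormedAddCommGroup E := N.toNormedAddCommGroup
  let _ : NormedSpace ℝ E := ⟨fun a x => (hsmul a x).le⟩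
  let g : E →L[ℝ] ℝ := ⟨f, f.continuous_of_finiteDimensional⟩
  exact ⟨‖g‖, fun x hx => (le_abs_self _).trans (g.unit_le_opNorm x hx)⟩

theorem sum_mul_le_dualNorm {m : ℕ} {nrm : (Fin m → ℝ) → ℝ}
    (hzero : ∀ x, nrm x = 0 ↔ x = 0)
    (hsmul : ∀ (a : ℝ) (x : Fin m → ℝ), nrm (a • x) = |a| * nrm x)
    (htri : ∀ x y, nrm (x + y) ≤ nrm x + nrm y)
    (z : Fin m → ℝ) {x : Fin m → ℝ} (hx : nrm x ≤ 1) :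
    ∑ i, z i * x i ≤ dualNorm m nrm z := by
  obtain ⟨C, hC⟩ := exists_forall_le_of_norm_le_one nrm hzero hsmul htri
    (∑ i, z i • LinearMap.proj (R := ℝ) (φ := fun _ : Fin m => ℝ) i)
  refine le_csSup ⟨C, ?_⟩ ⟨x, hx, rfl⟩
  rintro _ ⟨y, hy, rfl⟩
  simpa using hC y hy

theorem sum_combo_mul {m : ℕ} (a b : ℝ) (u v x : Fin m → ℝ) :
    ∑ i, (a • u + b • v) i * x i = a * ∑ i, u i * x i + b * ∑ i, v i * x i := by
  simp only [Finset.mul_sum, ← Finset.sum_add_distrib, Pi.add_apply, Pi.smul_apply, smul_eq_mul]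
  exact Finset.sum_congr rfl fun i _ => by ring

theorem dualNorm_combo_le {m : ℕ} {nrm : (Fin m → ℝ) → ℝ}
    (hzero : ∀ x, nrm x = 0 ↔ x = 0)
    (hsmul : ∀ (a : ℝ) (x : Fin m → ℝ), nrm (a • x) = |a| * nrm x)
    (htri : ∀ x y, nrm (x + y) ≤ nrm x + nrm y)
    {a b : ℝ} (ha : 0 ≤ a) (hb : 0 ≤ b) (u v : Fin m → ℝ) :
    dualNorm m nrm (a • u + b • v) ≤ a * dualNorm m nrm u + b * dualNorm m nrm v := by
  refine csSup_le ⟨_, 0, by simp [(hzero 0).2 rfl], rfl⟩ ?_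
  rintro _ ⟨x, hx, rfl⟩
  rw [sum_combo_mul]
  have hu := sum_mul_le_dualNorm hzero hsmul htri u hx
  have hv := sum_mul_le_dualNorm hzero hsmul htri v hx
  gcongr

/-- Convexity of the feasible region of the approximating program (Theorem 3):
for a concave transaction-cost adjustment `c`, the set of tuples
`(w, λ, s, z₁, …, z_N)` with `w` in the standard simplex, `c(w) + ⟨w, x⟩ > 0` on `𝔛`,
`λ ≥ 0`, `‖zⱼ‖_* ≤ λ`, and `log(c(w) + ⟨w, x⟩) + ⟨zⱼ, x − x̂ⱼ⟩ ≥ sⱼ` for all `x ∈ 𝔛`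
and all `j`, is convex. -/
theorem feasible_set_convex
    (m N : ℕ)
    (nrm : (Fin m → ℝ) → ℝ)
    (hnrm_zero : ∀ x, nrm x = 0 ↔ x = 0)
    (hnrm_smul : ∀ (a : ℝ) (x : Fin m → ℝ), nrm (a • x) = |a| * nrm x)
    (hnrm_tri : ∀ x y, nrm (x + y) ≤ nrm x + nrm y)
    (X : Set (Fin m → ℝ))
    (xs : Fin N → (Fin m → ℝ))
    (c : (Fin m → ℝ) → ℝ) (hc : ConcaveOn ℝ Set.univ c) :
    Convex ℝ {p : (Fin m → ℝ) × ℝ × (Fin N → ℝ) × (Fin N → (Fin m → ℝ)) |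
      (∑ i, p.1 i = 1 ∧ ∀ i, 0 ≤ p.1 i) ∧
      (∀ x ∈ X, 0 < c p.1 + ∑ i, p.1 i * x i) ∧
      0 ≤ p.2.1 ∧
      (∀ j, dualNorm m nrm (p.2.2.2 j) ≤ p.2.1) ∧
      (∀ x ∈ X, ∀ j, Real.log (c p.1 + ∑ i, p.1 i * x i)
          + ∑ i, p.2.2.2 j i * (x i - xs j i) ≥ p.2.2.1 j)} := by
  rintro ⟨w, l, s, z⟩ ⟨⟨hw1, hw0⟩, hpos, hl, hz, hlog⟩
    ⟨w', l', s', z'⟩ ⟨⟨hw1', hw0'⟩, hpos', hl', hz', hlog'⟩ a b ha hb hab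
  dsimp only at hw1 hw0 hpos hl hz hlog hw1' hw0' hpos' hl' hz' hlog'
  have hconc (x : Fin m → ℝ) :
      a * (c w + ∑ i, w i * x i) + b * (c w' + ∑ i, w' i * x i)
        ≤ c (a • w + b • w') + ∑ i, (a • w + b • w') i * x i := by
    have h := hc.2 (Set.mem_univ w) (Set.mem_univ w') ha hb hab
    rw [sum_combo_mul]
    simp only [smul_eq_mul] at h
    linarith
  have hcombo_pos (x) (hx : x ∈ X) :
      0 < a * (c w + ∑ i, w i * x i) + b * (c w' + ∑ i, w' i * x i) :=
    convex_Ioi (0 : ℝ) (hpos x hx) (hpos' x hx) ha hb hab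
  refine ⟨⟨?_, fun i => ?_⟩, fun x hx => (hcombo_pos x hx).trans_le (hconc x), ?_,
    fun j => ?_, fun x hx j => ?_⟩
  · have h := sum_combo_mul a b w w' 1
    simp only [Pi.one_apply, mul_one, hw1, hw1', hab] at h
    exact h
  · exact add_nonneg (mul_nonneg ha (hw0 i)) (mul_nonneg hb (hw0' i))
  · exact add_nonneg (mul_nonneg ha hl) (mul_nonneg hb hl')
  · exact (dualNorm_combo_le hnrm_zero hnrm_smul hnrm_tri ha hb _ _).trans
      (add_le_add (mul_le_mul_of_nonneg_left (hz j) ha) (mul_le_mul_of_nonneg_left (hz' j) hb))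
  · have h1 := strictConcaveOn_log_Ioi.concaveOn.2 (hpos x hx) (hpos' x hx) ha hb hab
    have h2 := Real.log_le_log (hcombo_pos x hx) (hconc x)
    have h3 := sum_combo_mul a b (z j) (z' j) (x - xs j)
    have h4 := mul_le_mul_of_nonneg_left (hlog x hx j) ha
    have h5 := mul_le_mul_of_nonneg_left (hlog' x hx j) hb
    simp only [smul_eq_mul, Pi.sub_apply] at h1 h3
    change a * s j + b * s' j ≤ Real.log (c (a • w + b • w') + ∑ i, (a • w + b • w') i * x i)
      + ∑ i, (a • z j + b • z' j) i * (x i - xs j i)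
    rw [h3]
    linarith
end

section
/- Let ‖·‖ be a norm on ℝ^m with dual norm ‖·‖_*, let 𝔛 ⊂ ℝ^m be nonempty, let x̂_1, …, x̂_N ∈ 𝔛, let ε ≥ 0, and let f : ℝ^m → ℝ. Suppose (λ, s_1, …, s_N, z_1, …, z_N) satisfies λ ≥ 0, ‖z_j‖_* ≤ λ for all j, and f(x) + ⟨z_j, x − x̂_j⟩ ≥ s_j for all x ∈ 𝔛 and all j. Then for every tuple F_1, …, F_N of Borel probability measures supported on 𝔛 with f integrable, ‖x − x̂_j‖ integrable, and (1/N) Σ_{j=1}^N ∫ ‖x − x̂_j‖ dF_j(x) ≤ ε, one has −λε + (1/N) Σ_{j=1}^N s_j ≤ (1/N) Σ_{j=1}^N ∫ f dF_j. -/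
open MeasureTheory

/-- A linear functional on a finite-dimensional space is bounded with respect to any norm. -/
lemma exists_le_mul_norm_of_finiteDimensional {E : Type*} [AddCommGroup E] [Module ℝ E]
    [FiniteDimensional ℝ E] (nrm : E → ℝ)
    (hzero : ∀ x, nrm x = 0 ↔ x = 0)
    (hsmul : ∀ (a : ℝ) (x : E), nrm (a • x) = |a| * nrm x)
    (htri : ∀ x y, nrm (x + y) ≤ nrm x + nrm y)
    (hnonneg : ∀ x, 0 ≤ nrm x) (φ : E →ₗ[ℝ] ℝ) :
    ∃ C : ℝ, 0 ≤ C ∧ ∀ x, φ x ≤ C * nrm x := by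
  let _ : Norm E := ⟨nrm⟩
  have core : NormedSpace.Core ℝ E :=
    { norm_nonneg := hnonneg
      norm_smul := hsmul
      norm_triangle := htri
      norm_eq_zero_iff := hzero }
  let _ : NormedAddCommGroup E := NormedAddCommGroup.ofCore core
  let _ : NormedSpace ℝ E := NormedSpace.ofCore core
  refine ⟨‖LinearMap.toContinuousLinearMap φ‖, norm_nonneg _, fun x => ?_⟩
  exact (le_abs_self _).trans ((LinearMap.toContinuousLinearMap φ).le_opNorm x)

/-- The defining inequality of the dual norm. -/
lemma sum_mul_le_dualNorm_mul (m : ℕ) (nrm : (Fin m → ℝ) → ℝ)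
    (hzero : ∀ x, nrm x = 0 ↔ x = 0)
    (hsmul : ∀ (a : ℝ) (x : Fin m → ℝ), nrm (a • x) = |a| * nrm x)
    (htri : ∀ x y, nrm (x + y) ≤ nrm x + nrm y)
    (hnonneg : ∀ x, 0 ≤ nrm x) (z x : Fin m → ℝ) :
    ∑ i, z i * x i ≤ dualNorm m nrm z * nrm x := by
  obtain ⟨C, hC, hle⟩ := exists_le_mul_norm_of_finiteDimensional nrm hzero hsmul htri hnonneg
    (dotProductBilin ℝ ℝ z)
  have hbdd : BddAbove {p : ℝ | ∃ x : Fin m → ℝ, nrm x ≤ 1 ∧ p = ∑ i, z i * x i} := by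
    refine ⟨C, ?_⟩
    rintro p ⟨y, hy, rfl⟩
    exact (hle y).trans (mul_le_of_le_one_right hC hy)
  rcases eq_or_ne x 0 with rfl | hx
  · simp [(hzero 0).2 rfl]
  · have hpos : 0 < nrm x := (hnonneg x).lt_of_ne' fun h => hx ((hzero x).1 h)
    have hmem : (nrm x)⁻¹ * ∑ i, z i * x i ≤ dualNorm m nrm z := by
      refine le_csSup hbdd ⟨(nrm x)⁻¹ • x, ?_, ?_⟩
      · rw [hsmul, abs_of_pos (inv_pos.2 hpos), inv_mul_cancel₀ hpos.ne']
      · rw [Finset.mul_sum]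
        exact Finset.sum_congr rfl fun i _ => by simp only [Pi.smul_apply, smul_eq_mul]; ring
    rwa [inv_mul_le_iff₀ hpos, mul_comm] at hmem

/-- A lower bound for an a.e.-measurable function that holds on a set of full outer measure
holds almost everywhere, even when the set is not measurable. -/
lemma ae_le_of_forall_mem_of_measure_eq_one {α : Type*} [MeasurableSpace α] {μ : Measure α}
    [IsProbabilityMeasure μ] {X : Set α} (hX : μ X = 1) {g : α → ℝ} (hg : AEMeasurable g μ)
    {c : ℝ} (h : ∀ x ∈ X, c ≤ g x) : ∀ᵐ x ∂μ, c ≤ g x := by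
  have hmeas : NullMeasurableSet {x | c ≤ g x} μ := hg.nullMeasurable measurableSet_Ici
  refine (prob_compl_eq_zero_iff₀ hmeas).2 (le_antisymm prob_le_one ?_)
  exact hX ▸ measure_mono h

/-- Theorem 3 (Convex Approximation), lower-bound content: any feasible point
`(λ, s, z₁, …, z_N)` of the finite convex program lower-bounds the expected value
of `f` under every tuple of distributions supported on `𝔛` whose transport cost
from the empirical distribution is at most `ε`. -/
theorem dual_feasible_point_lower_bounds_primal
    (m N : ℕ) (hN : 0 < N)
    (nrm : (Fin m → ℝ) → ℝ)
    (hnrm_zero : ∀ x, nrm x = 0 ↔ x = 0)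
    (hnrm_smul : ∀ (a : ℝ) (x : Fin m → ℝ), nrm (a • x) = |a| * nrm x)
    (hnrm_tri : ∀ x y, nrm (x + y) ≤ nrm x + nrm y)
    (X : Set (Fin m → ℝ)) (hXne : X.Nonempty)
    (xs : Fin N → (Fin m → ℝ)) (hxsX : ∀ j, xs j ∈ X)
    (ε : ℝ) (hε : 0 ≤ ε)
    (f : (Fin m → ℝ) → ℝ)
    (l : ℝ) (s : Fin N → ℝ) (z : Fin N → (Fin m → ℝ))
    (hl : 0 ≤ l)
    (hz : ∀ j, dualNorm m nrm (z j) ≤ l)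
    (hconstr : ∀ x ∈ X, ∀ j, f x + ∑ i, z j i * (x i - xs j i) ≥ s j)
    (F : Fin N → Measure (Fin m → ℝ))
    (hFprob : ∀ j, IsProbabilityMeasure (F j)) (hFsupp : ∀ j, F j X = 1)
    (hfint : ∀ j, Integrable f (F j))
    (hnrmint : ∀ j, Integrable (fun x => nrm (x - xs j)) (F j))
    (htransport : (1 / N : ℝ) * ∑ j, ∫ x, nrm (x - xs j) ∂(F j) ≤ ε) :
    -l * ε + (1 / N : ℝ) * ∑ j, s j ≤ (1 / N : ℝ) * ∑ j, ∫ x, f x ∂(F j) := by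
  have hnonneg : ∀ x, 0 ≤ nrm x := fun x => by
    have h := hnrm_tri x ((-1 : ℝ) • x)
    rw [hnrm_smul, neg_one_smul, add_neg_cancel, (hnrm_zero 0).2 rfl, abs_neg, abs_one] at h
    linarith
  have hint : ∀ j, s j ≤ ∫ x, f x ∂(F j) + l * ∫ x, nrm (x - xs j) ∂(F j) := fun j => by
    have := hFprob j
    have hg : Integrable (fun x => f x + l * nrm (x - xs j)) (F j) :=
      (hfint j).add ((hnrmint j).const_mul l)
    have hae : ∀ᵐ x ∂(F j), s j ≤ f x + l * nrm (x - xs j) := by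
      refine ae_le_of_forall_mem_of_measure_eq_one (hFsupp j) hg.aemeasurable fun x hx => ?_
      have hdual := sum_mul_le_dualNorm_mul m nrm hnrm_zero hnrm_smul hnrm_tri hnonneg (z j)
        (x - xs j)
      have hle := mul_le_mul_of_nonneg_right (hz j) (hnonneg (x - xs j))
      have hx' := hconstr x hx j
      simp only [Pi.sub_apply] at hdual
      linarith
    have hmono := integral_mono_ae (integrable_const (s j)) hg hae
    rw [integral_add (hfint j) ((hnrmint j).const_mul l), integral_const_mul] at hmono
    simpa using hmono
  have hsum := Finset.sum_le_sum fun j (_ : j ∈ Finset.univ) => hint j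
  rw [Finset.sum_add_distrib, ← Finset.mul_sum] at hsum
  have hscaled := mul_le_mul_of_nonneg_left hsum (by positivity : (0 : ℝ) ≤ 1 / N)
  have hcost := mul_le_mul_of_nonneg_left htransport hl
  linarith
end

section
/- Let a, b ∈ ℝ^m with a_i ≤ b_i for all i, and let 𝔛 = {x ∈ ℝ^m : a_i ≤ x_i ≤ b_i for all i} be the box. Let w ∈ ℝ^m with w_i ≥ 0 for all i, let c ∈ ℝ satisfy c + ⟨w, a⟩ > 0, and let z ∈ ℝ^m, x̂ ∈ ℝ^m, s ∈ ℝ. Then the semi-infinite constraint 'log(c + ⟨w, x⟩) + ⟨z, x − x̂⟩ ≥ s for all x ∈ 𝔛' holds if and only if 'log(c + ⟨w, v⟩) + ⟨z, v − x̂⟩ ≥ s for all vertices v of the box', i.e., for all v ∈ ℝ^m with v_i ∈ {a_i, b_i} for each i. -/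
/-- A closed box in `ι → ℝ` is the convex hull of its vertices. -/
theorem convexHull_univ_pi_pair_eq_Icc {ι : Type*} [Finite ι] {a b : ι → ℝ}
    (hab : ∀ i, a i ≤ b i) :
    convexHull ℝ (Set.univ.pi fun i => ({a i, b i} : Set ℝ)) = Set.Icc a b := by
  rw [convexHull_pi, ← Set.pi_univ_Icc]
  simp only [convexHull_pair, segment_eq_Icc (hab _)]

/-- The logarithm of a positive affine function plus an affine function is concave on a box. -/
theorem concaveOn_log_affine_add_affine {ι : Type*} [Fintype ι] (a b w : ι → ℝ)
    (hw : ∀ i, 0 ≤ w i) (c : ℝ) (hc : 0 < c + ∑ i, w i * a i) (z xh : ι → ℝ) :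
    ConcaveOn ℝ (Set.Icc a b)
      (fun x => Real.log (c + ∑ i, w i * x i) + ∑ i, z i * (x i - xh i)) := by
  have pos : ∀ x ∈ Set.Icc a b, 0 < c + ∑ i, w i * x i := fun x hx =>
    hc.trans_le <| by gcongr with i _; exacts [hw i, hx.1 i]
  have affine : ∀ (u : ι → ℝ) (d : ℝ) (x y : ι → ℝ) (p q : ℝ), p + q = 1 →
      d + ∑ i, u i * (p • x + q • y) i
        = p * (d + ∑ i, u i * x i) + q * (d + ∑ i, u i * y i) := by
    intro u d x y p q hpq
    have hsum : ∑ i, u i * (p • x + q • y) i = p * ∑ i, u i * x i + q * ∑ i, u i * y i := by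
      rw [Finset.mul_sum, Finset.mul_sum, ← Finset.sum_add_distrib]
      refine Finset.sum_congr rfl fun i _ => ?_
      simp only [Pi.add_apply, Pi.smul_apply, smul_eq_mul]
      ring
    rw [hsum]
    linear_combination (-d) * hpq
  refine ⟨convex_Icc a b, fun x hx y hy p q hp hq hpq => ?_⟩
  have hlog := strictConcaveOn_log_Ioi.concaveOn.2 (pos x hx) (pos y hy) hp hq hpq
  have hlin := affine z (-∑ i, z i * xh i) x y p q hpq
  simp only [smul_eq_mul, mul_sub, Finset.sum_sub_distrib] at hlog ⊢
  rw [affine w c x y p q hpq]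
  linarith

/-- Corollary 4 (Reduction of Semi-Infinite Constraint): on the box
`𝔛 = {x | aᵢ ≤ xᵢ ≤ bᵢ}`, with `wᵢ ≥ 0` and `c + ⟨w, a⟩ > 0`, the semi-infinite
constraint `log(c + ⟨w, x⟩) + ⟨z, x − x̂⟩ ≥ s` for all `x ∈ 𝔛` holds iff it holds
at every vertex `v` of the box (`vᵢ ∈ {aᵢ, bᵢ}`). -/
theorem semi_infinite_constraint_vertex_reduction
    (m : ℕ) (a b : Fin m → ℝ) (hab : ∀ i, a i ≤ b i)
    (w : Fin m → ℝ) (hw : ∀ i, 0 ≤ w i)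
    (c : ℝ) (hc : 0 < c + ∑ i, w i * a i)
    (z xh : Fin m → ℝ) (s : ℝ) :
    (∀ x : Fin m → ℝ, (∀ i, a i ≤ x i ∧ x i ≤ b i) →
        Real.log (c + ∑ i, w i * x i) + ∑ i, z i * (x i - xh i) ≥ s)
      ↔ (∀ v : Fin m → ℝ, (∀ i, v i = a i ∨ v i = b i) →
        Real.log (c + ∑ i, w i * v i) + ∑ i, z i * (v i - xh i) ≥ s) := by
  constructor
  · intro h v hv
    refine h v fun i => ?_
    rcases hv i with hi | hi <;> simp [hi, hab i]
  · intro h x hx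
    have hhull := convexHull_univ_pi_pair_eq_Icc hab
    obtain ⟨v, hv, hvx⟩ :=
      (concaveOn_log_affine_add_affine a b w hw c hc z xh).exists_le_of_mem_convexHull
        ((subset_convexHull ℝ _).trans hhull.le)
        (hhull.ge ⟨fun i => (hx i).1, fun i => (hx i).2⟩)
    exact (h v fun i => hv i (Set.mem_univ i)).trans hvx
end

section
/- Let ‖·‖ be a norm on ℝ^m with dual norm ‖·‖_*, let 𝔛 ⊂ ℝ^m be nonempty, let x̂_1, …, x̂_N ∈ 𝔛, let ε > 0, and let w ∈ ℝ^m, c ∈ ℝ satisfy c + ⟨w, x⟩ > 0 for all x ∈ 𝔛. Let M ∈ ℝ. Then every feasible point (λ, s, z_1, …, z_N) of the dual program (λ ≥ 0, ‖z_j‖_* ≤ λ, and log(c + ⟨w, x⟩) + ⟨z_j, x − x̂_j⟩ ≥ s_j for all x ∈ 𝔛 and all j) whose objective value satisfies −λε + (1/N) Σ_{j=1}^N s_j ≥ M must satisfy λ ≤ ( (1/N) Σ_{j=1}^N log(c + ⟨w, x̂_j⟩) − M ) / ε, and consequently ‖z_j‖_* ≤ ( (1/N) Σ_{j=1}^N log(c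 + ⟨w, x̂_j⟩) − M ) / ε for all j. -/
/-- Boundedness part of Lemma 7: when `ε > 0`, every feasible point of the dual
program whose objective value is at least `M` has multiplier
`λ ≤ ((1/N) ∑ⱼ log(c + ⟨w, x̂ⱼ⟩) − M)/ε`, and hence all `‖zⱼ‖_*` obey the same
bound. -/
theorem dual_program_multipliers_bounded
    (m N : ℕ) (hN : 0 < N)
    (nrm : (Fin m → ℝ) → ℝ)
    (hnrm_zero : ∀ x, nrm x = 0 ↔ x = 0)
    (hnrm_smul : ∀ (a : ℝ) (x : Fin m → ℝ), nrm (a • x) = |a| * nrm x)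
    (hnrm_tri : ∀ x y, nrm (x + y) ≤ nrm x + nrm y)
    (X : Set (Fin m → ℝ)) (hXne : X.Nonempty)
    (xs : Fin N → (Fin m → ℝ)) (hxsX : ∀ j, xs j ∈ X)
    (ε : ℝ) (hε : 0 < ε)
    (w : Fin m → ℝ) (c : ℝ) (hpos : ∀ x ∈ X, 0 < c + ∑ i, w i * x i)
    (M : ℝ)
    (l : ℝ) (s : Fin N → ℝ) (z : Fin N → (Fin m → ℝ))
    (hl : 0 ≤ l)
    (hz : ∀ j, dualNorm m nrm (z j) ≤ l)
    (hconstr : ∀ x ∈ X, ∀ j, Real.log (c + ∑ i, w i * x i)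
        + ∑ i, z j i * (x i - xs j i) ≥ s j)
    (hobj : -l * ε + (1 / N : ℝ) * ∑ j, s j ≥ M) :
    l ≤ ((1 / N : ℝ) * ∑ j, Real.log (c + ∑ i, w i * xs j i) - M) / ε ∧
    ∀ j, dualNorm m nrm (z j)
        ≤ ((1 / N : ℝ) * ∑ j, Real.log (c + ∑ i, w i * xs j i) - M) / ε := by
  have hs : ∀ j, s j ≤ Real.log (c + ∑ i, w i * xs j i) := fun j => by
    simpa using hconstr (xs j) (hxsX j) j
  have hmean : (1 / N : ℝ) * ∑ j, s j ≤ (1 / N : ℝ) * ∑ j, Real.log (c + ∑ i, w i * xs j i) :=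
    mul_le_mul_of_nonneg_left (Finset.sum_le_sum fun j _ => hs j) (by positivity)
  have hlam : l ≤ ((1 / N : ℝ) * ∑ j, Real.log (c + ∑ i, w i * xs j i) - M) / ε := by
    rw [le_div_iff₀ hε]
    linarith
  exact ⟨hlam, fun j => (hz j).trans hlam⟩
end
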